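/- arXiv:math/0411338 — 8 statements merged into one kernel-verified Lean document; each statement's English description precedes it below -/
import Mathlib

section
/- For every S ∈ 𝒮, the function d_S : S × S → [0,+∞) is continuous (with S × S carrying the topology induced from X × X). -/
open Set MeasureTheory
open scoped NNReal ENNReal

noncomputable section

/-- `X d` is the `d`-dimensional Euclidean space. -/
abbrev X (d : ℕ) := EuclideanSpace ℝ (Fin d)

/-- An admissible change of variables for `S`: a bijection of `X d` which is
Lipschitz together with its inverse and which maps `S` onto a convex set. -/
def Admissible (d : ℕ) (φ : X d ≃ X d) (S : Set (X d)) : Prop :=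
  (∃ K : ℝ≥0, LipschitzWith K φ) ∧ (∃ K : ℝ≥0, LipschitzWith K φ.symm) ∧ Convex ℝ (φ '' S)

/-- The class `𝒮`: compact subsets of `X d` admitting an admissible change of variables. -/
def MemS (d : ℕ) (S : Set (X d)) : Prop :=
  IsCompact S ∧ ∃ φ : X d ≃ X d, Admissible d φ S

/-- A Lipschitz arc in `S` starting at `x0` and ending at `x1`. -/
def IsArc (d : ℕ) (S : Set (X d)) (x0 x1 : X d) (ψ : ℝ → X d) : Prop :=
  (∃ K : ℝ≥0, LipschitzOnWith K ψ (Icc 0 1)) ∧ MapsTo ψ (Icc 0 1) S ∧ ψ 0 = x0 ∧ ψ 1 = x1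

/-- Length of an arc: integral of the norm of its (a.e.) derivative. -/
def len (d : ℕ) (ψ : ℝ → X d) : ℝ := ∫ t in (0:ℝ)..1, ‖deriv ψ t‖

/-- The geodesic distance `d_S`: infimum of lengths of Lipschitz arcs in `S`
joining `x0` to `x1` (equal to `⊤` if no such arc exists). -/
def dSE (d : ℕ) (S : Set (X d)) (x0 x1 : X d) : ℝ≥0∞ :=
  ⨅ (ψ : ℝ → X d) (_ : IsArc d S x0 x1 ψ), ENNReal.ofReal (len d ψ)

/-- `μ(S)`: supremum of `d_S` over pairs of points of `S`. -/
def muE (d : ℕ) (S : Set (X d)) : ℝ≥0∞ :=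
  ⨆ x0 ∈ S, ⨆ x1 ∈ S, dSE d S x0 x1

/-- The norm of the derivative of an arc is integrable on every subinterval of `[0, 1]`. -/
theorem IsArc.intervalIntegrable {d : ℕ} {S : Set (X d)} {x0 x1 : X d} {ψ : ℝ → X d}
    (h : IsArc d S x0 x1 ψ) {a b : ℝ} (ha : 0 ≤ a) (hab : a ≤ b) (hb : b ≤ 1) :
    IntervalIntegrable (fun t => ‖deriv ψ t‖) volume a b := by
  obtain ⟨⟨K, hK⟩, -⟩ := h
  rw [intervalIntegrable_iff_integrableOn_Ioo_of_le hab]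
  refine Measure.integrableOn_of_bounded (M := K) (by simp)
    (measurable_deriv ψ).norm.aestronglyMeasurable ?_
  filter_upwards [ae_restrict_mem measurableSet_Ioo] with t ht
  rw [norm_norm]
  exact norm_deriv_le_of_lipschitzOn
    (Icc_mem_nhds (ha.trans_lt ht.1) (ht.2.trans_le hb)) hK

theorem len_nonneg (d : ℕ) (ψ : ℝ → X d) : 0 ≤ len d ψ :=
  intervalIntegral.integral_nonneg zero_le_one fun _ _ => norm_nonneg _

theorem len_le_of_lipschitzOnWith {d : ℕ} {ψ : ℝ → X d} {K : ℝ≥0}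
    (hK : LipschitzOnWith K ψ (Icc 0 1)) : len d ψ ≤ K := by
  have h := intervalIntegral.norm_integral_le_of_norm_le_const_ae (a := 0) (b := 1) (C := K)
    (f := fun t => ‖deriv ψ t‖) ?_
  · rw [sub_zero, abs_one, mul_one] at h
    exact (le_abs_self _).trans h
  · filter_upwards [compl_mem_ae_iff.2 (measure_singleton (1 : ℝ))] with t ht1 ht
    rw [uIoc_of_le zero_le_one] at ht
    rw [norm_norm]
    exact norm_deriv_le_of_lipschitzOn (Icc_mem_nhds ht.1 (lt_of_le_of_ne ht.2 ht1)) hK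

/-- The concatenation of two arcs joining `x0` to `y` and `y` to `x1`, each run at double speed. -/
def arcConcat {d : ℕ} (y : X d) (ψ₁ ψ₂ : ℝ → X d) (t : ℝ) : X d :=
  ψ₁ (min (2 * t) 1) + ψ₂ (max (2 * t - 1) 0) - y

section Concat

variable {d : ℕ} {S : Set (X d)} {x0 y x1 : X d} {ψ₁ ψ₂ : ℝ → X d}

theorem arcConcat_of_le_half (h₂ : IsArc d S y x1 ψ₂) {t : ℝ} (ht : t ≤ 1 / 2) :
    arcConcat y ψ₁ ψ₂ t = ψ₁ (2 * t) := by
  rw [arcConcat, min_eq_left (by linarith), max_eq_right (by linarith), h₂.2.2.1,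
    add_sub_cancel_right]

theorem arcConcat_of_half_le (h₁ : IsArc d S x0 y ψ₁) {t : ℝ} (ht : 1 / 2 ≤ t) :
    arcConcat y ψ₁ ψ₂ t = ψ₂ (2 * t - 1) := by
  rw [arcConcat, min_eq_right (by linarith), max_eq_left (by linarith), h₁.2.2.2,
    add_sub_cancel_left]

theorem IsArc.trans (h₁ : IsArc d S x0 y ψ₁) (h₂ : IsArc d S y x1 ψ₂) :
    IsArc d S x0 x1 (arcConcat y ψ₁ ψ₂) := by
  refine ⟨?_, fun t ht => ?_, ?_, ?_⟩
  · obtain ⟨K₁, hK₁⟩ := h₁.1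
    obtain ⟨K₂, hK₂⟩ := h₂.1
    have hd : LipschitzWith 2 (fun t : ℝ => 2 * t) :=
      LipschitzWith.of_dist_le_mul fun s t => by
        simp [Real.dist_eq, ← mul_sub, abs_mul]
    have hd' : LipschitzWith 2 (fun t : ℝ => 2 * t - 1) :=
      LipschitzWith.of_dist_le_mul fun s t => by
        simp [Real.dist_eq, ← mul_sub, abs_mul]
    have e₁ := hK₁.comp (f := fun t : ℝ => min (2 * t) 1)
      ((hd.min_const 1).lipschitzOnWith (s := Icc 0 1))
      fun t ht => ⟨le_min (by linarith [ht.1]) zero_le_one, min_le_right _ _⟩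
    have e₂ := hK₂.comp (f := fun t : ℝ => max (2 * t - 1) 0)
      ((hd'.max_const 0).lipschitzOnWith (s := Icc 0 1))
      fun t ht => ⟨le_max_right _ _, max_le (by linarith [ht.2]) zero_le_one⟩
    exact ⟨_, (e₁.add e₂).sub (LipschitzWith.const y).lipschitzOnWith⟩
  · rcases le_total t (1 / 2) with h | h
    · rw [arcConcat_of_le_half h₂ h]
      exact h₁.2.1 ⟨by linarith [ht.1], by linarith⟩
    · rw [arcConcat_of_half_le h₁ h]
      exact h₂.2.1 ⟨by linarith, by linarith [ht.2]⟩
  · rw [arcConcat_of_le_half h₂ (by norm_num), mul_zero, h₁.2.2.1]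
  · rw [arcConcat_of_half_le h₁ (by norm_num), ← h₂.2.2.2]
    norm_num

theorem len_arcConcat (h₁ : IsArc d S x0 y ψ₁) (h₂ : IsArc d S y x1 ψ₂) :
    len d (arcConcat y ψ₁ ψ₂) = len d ψ₁ + len d ψ₂ := by
  have h := h₁.trans h₂
  rw [len, ← intervalIntegral.integral_add_adjacent_intervals (b := 1 / 2)
    (h.intervalIntegrable le_rfl (by norm_num) (by norm_num))
    (h.intervalIntegrable (by norm_num) (by norm_num) le_rfl)]
  congr 1
  · have e : ∀ t ∈ Ioo (0 : ℝ) (1 / 2),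
        ‖deriv (arcConcat y ψ₁ ψ₂) t‖ = 2 * ‖deriv ψ₁ (2 * t)‖ := fun t ht => by
      have : arcConcat y ψ₁ ψ₂ =ᶠ[nhds t] fun t => ψ₁ (2 * t) := by
        filter_upwards [Iio_mem_nhds ht.2] with s hs using arcConcat_of_le_half h₂ (le_of_lt hs)
      rw [this.deriv_eq, deriv_comp_mul_left, norm_smul]
      norm_num
    rw [intervalIntegral.integral_congr_Ioo_of_le (by norm_num) e,
      intervalIntegral.integral_const_mul,
      intervalIntegral.mul_integral_comp_mul_left (f := fun t => ‖deriv ψ₁ t‖)]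
    norm_num [len]
  · have e : ∀ t ∈ Ioo (1 / 2 : ℝ) 1,
        ‖deriv (arcConcat y ψ₁ ψ₂) t‖ = 2 * ‖deriv ψ₂ (2 * t - 1)‖ := fun t ht => by
      have : arcConcat y ψ₁ ψ₂ =ᶠ[nhds t] fun t => (fun s => ψ₂ (s - 1)) (2 * t) := by
        filter_upwards [Ioi_mem_nhds ht.1] with s hs using arcConcat_of_half_le h₁ (le_of_lt hs)
      rw [this.deriv_eq, deriv_comp_mul_left 2 (fun s => ψ₂ (s - 1)), deriv_comp_sub_const,
        norm_smul]
      norm_num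
    rw [intervalIntegral.integral_congr_Ioo_of_le (by norm_num) e,
      intervalIntegral.integral_const_mul,
      intervalIntegral.mul_integral_comp_mul_sub (f := fun t => ‖deriv ψ₂ t‖)]
    norm_num [len]

end Concat

theorem dSE_triangle (d : ℕ) (S : Set (X d)) (x y z : X d) :
    dSE d S x z ≤ dSE d S x y + dSE d S y z := by
  refine ENNReal.le_iInf₂_add_iInf₂ fun ψ₁ h₁ ψ₂ h₂ => ?_
  rw [← ENNReal.ofReal_add (len_nonneg d ψ₁) (len_nonneg d ψ₂), ← len_arcConcat h₁ h₂]
  exact iInf₂_le _ (h₁.trans h₂)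

/-- On a set of the class `𝒮`, the geodesic distance is controlled by the Euclidean distance. -/
theorem MemS.exists_dSE_le {d : ℕ} {S : Set (X d)} (hS : MemS d S) :
    ∃ C : ℝ≥0, ∀ x ∈ S, ∀ y ∈ S, dSE d S x y ≤ C * edist x y := by
  obtain ⟨-, φ, ⟨K, hK⟩, ⟨L, hL⟩, hc⟩ := hS
  refine ⟨L * K, fun x hx y hy => ?_⟩
  have hψ : LipschitzWith (L * nndist (φ x) (φ y))
      (fun t : ℝ => φ.symm (AffineMap.lineMap (φ x) (φ y) t)) :=
    hL.comp (lipschitzWith_lineMap (φ x) (φ y))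
  have harc : IsArc d S x y (fun t : ℝ => φ.symm (AffineMap.lineMap (φ x) (φ y) t)) := by
    refine ⟨⟨_, hψ.lipschitzOnWith⟩, fun t ht => ?_, by simp, by simp⟩
    obtain ⟨s, hs, hst⟩ :=
      hc.lineMap_mem (mem_image_of_mem φ hx) (mem_image_of_mem φ hy) ht
    simpa only [← hst, φ.symm_apply_apply] using hs
  calc dSE d S x y ≤ ENNReal.ofReal (len d _) := iInf₂_le _ harc
    _ ≤ ENNReal.ofReal (L * nndist (φ x) (φ y) : ℝ≥0) :=
        ENNReal.ofReal_le_ofReal (len_le_of_lipschitzOnWith hψ.lipschitzOnWith)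
    _ = L * edist (φ x) (φ y) := by
        rw [ENNReal.ofReal_coe_nnreal, ENNReal.coe_mul, edist_nndist]
    _ ≤ L * (K * edist x y) := by gcongr; exact hK x y
    _ = (L * K : ℝ≥0) * edist x y := by rw [ENNReal.coe_mul, mul_assoc]

/-- for `S ∈ 𝒮`, the function `d_S : S × S → [0,+∞)` is continuous
(for the topology induced from `X × X`). -/
theorem stmt1 (d : ℕ) (S : Set (X d)) (hS : MemS d S) :
    ContinuousOn (fun p : X d × X d => (dSE d S p.1 p.2).toReal) (S ×ˢ S) := by
  obtain ⟨C, hC⟩ := hS.exists_dSE_le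
  have hfin : ∀ x ∈ S, ∀ y ∈ S, dSE d S x y ≠ ⊤ := fun x hx y hy =>
    ne_top_of_le_ne_top (ENNReal.mul_ne_top ENNReal.coe_ne_top (edist_ne_top x y)) (hC x hx y hy)
  have hC' : ∀ x ∈ S, ∀ y ∈ S, (dSE d S x y).toReal ≤ C * dist x y := fun x hx y hy => by
    have h := ENNReal.toReal_mono (ENNReal.mul_ne_top ENNReal.coe_ne_top (edist_ne_top x y))
      (hC x hx y hy)
    rwa [ENNReal.toReal_mul, ENNReal.coe_toReal, ← dist_edist] at h
  have htri : ∀ x ∈ S, ∀ y ∈ S, ∀ z ∈ S,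
      (dSE d S x z).toReal ≤ (dSE d S x y).toReal + (dSE d S y z).toReal :=
    fun x hx y hy z hz => by
      rw [← ENNReal.toReal_add (hfin x hx y hy) (hfin y hy z hz)]
      exact ENNReal.toReal_mono (ENNReal.add_ne_top.2 ⟨hfin x hx y hy, hfin y hy z hz⟩)
        (dSE_triangle d S x y z)
  refine (LipschitzOnWith.of_le_add_mul (2 * C) ?_).continuousOn
  rintro ⟨x, y⟩ ⟨hx, hy⟩ ⟨x', y'⟩ ⟨hx', hy'⟩
  have h₁ := htri x hx x' hx' y hy
  have h₂ := htri x' hx' y' hy' y hy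
  have h₃ := hC' x hx x' hx'
  have h₄ := hC' y' hy' y hy
  have h₅ : C * dist x x' ≤ C * dist (x, y) (x', y') := by
    gcongr; exact le_max_left _ _
  have h₆ : C * dist y' y ≤ C * dist (x, y) (x', y') := by
    rw [dist_comm y' y]; gcongr; exact le_max_right _ _
  push_cast
  linarith

end
end

section
/- Let S ∈ 𝒮 and let φ : X → X be a bijection with φ Lipschitz of constant K_φ and φ⁻¹ Lipschitz of constant K_{φ⁻¹} such that φ(S) is convex. Then for all x, y ∈ S one has d_S(x,y) ≤ K_{φ⁻¹} · K_φ · ‖x − y‖; in particular d_S is Lipschitz-equivalent from above to the Euclidean distance on S. -/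
open Set MeasureTheory
open scoped NNReal ENNReal

noncomputable section

/-- The length of a Lipschitz arc is at most its Lipschitz constant. -/
theorem len_le_of_lipschitzWith {d : ℕ} {ψ : ℝ → X d} {K : ℝ≥0} (hψ : LipschitzWith K ψ) :
    len d ψ ≤ K := by
  have h := intervalIntegral.norm_integral_le_of_norm_le_const (a := 0) (b := 1)
    (f := fun t => ‖deriv ψ t‖) (C := K) fun t _ => by
      simpa using norm_deriv_le_of_lipschitz hψ
  simpa [len] using (le_abs_self _).trans h

/-- The geodesic distance is at most the Lipschitz constant of any arc. -/
theorem dSE_le_of_lipschitzWith {d : ℕ} {S : Set (X d)} {x y : X d} {ψ : ℝ → X d} {K : ℝ≥0}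
    (hψ : LipschitzWith K ψ) (hS : MapsTo ψ (Icc 0 1) S) (h0 : ψ 0 = x) (h1 : ψ 1 = y) :
    dSE d S x y ≤ K := by
  refine (iInf₂_le ψ ⟨⟨K, hψ.lipschitzOnWith⟩, hS, h0, h1⟩).trans ?_
  simpa using ENNReal.ofReal_le_ofReal (len_le_of_lipschitzWith hψ)

/-- if `φ` is a bijection, Lipschitz with constant `Kφ`, with inverse
Lipschitz with constant `Kinv`, and `φ(S)` is convex, then
`d_S(x,y) ≤ Kinv · Kφ · ‖x − y‖` for all `x, y ∈ S`. -/
theorem stmt3 (d : ℕ) (S : Set (X d)) (hScomp : IsCompact S)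
    (φ : X d ≃ X d) (Kφ Kinv : ℝ≥0)
    (hφ : LipschitzWith Kφ φ) (hφinv : LipschitzWith Kinv φ.symm)
    (hconv : Convex ℝ (φ '' S)) :
    ∀ x ∈ S, ∀ y ∈ S, dSE d S x y ≤ (Kinv : ℝ≥0∞) * (Kφ : ℝ≥0∞) * edist x y := by
  intro x hx y hy
  have hψ := hφinv.comp (lipschitzWith_lineMap (𝕜 := ℝ) (φ x) (φ y))
  refine (dSE_le_of_lipschitzWith hψ ?_ (by simp) (by simp)).trans ?_
  · intro t ht
    obtain ⟨z, hz, hzt⟩ := hconv.lineMap_mem (mem_image_of_mem φ hx) (mem_image_of_mem φ hy) ht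
    simpa [← hzt] using hz
  · rw [ENNReal.coe_mul, ← edist_nndist, mul_assoc]
    gcongr
    exact hφ x y

end
end

section
/- The map μ is lower semicontinuous on 𝒮 with respect to the Hausdorff metric: if (S_n) is a sequence of sets in 𝒮 converging to S ∈ 𝒮 in Hausdorff distance, then liminf_{n→∞} μ(S_n) ≥ μ(S). -/
open Set MeasureTheory
open scoped NNReal ENNReal

noncomputable section

/-- A function that is Lipschitz on an interval has integrable speed there. -/
theorem LipschitzOnWith.intervalIntegrable_norm_deriv {E : Type*} [NormedAddCommGroup E]
    [NormedSpace ℝ E] [CompleteSpace E] {f : ℝ → E} {K : ℝ≥0} {a b : ℝ} (hab : a ≤ b)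
    (hf : LipschitzOnWith K f (Icc a b)) :
    IntervalIntegrable (fun t => ‖deriv f t‖) volume a b := by
  rw [intervalIntegrable_iff_integrableOn_Ioo_of_le hab]
  refine IntegrableOn.of_bound (C := K) (by simp)
    (stronglyMeasurable_deriv f).norm.aestronglyMeasurable ?_
  filter_upwards [ae_restrict_mem measurableSet_Ioo] with t ht
  simpa using norm_deriv_le_of_lipschitzOn (Icc_mem_nhds ht.1 ht.2) hf

/-- The chord of a Lipschitz curve is at most the integral of its speed. -/
theorem LipschitzOnWith.norm_sub_le_integral_norm_deriv {E : Type*} [NormedAddCommGroup E]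
    [InnerProductSpace ℝ E] [FiniteDimensional ℝ E] {f : ℝ → E} {K : ℝ≥0} {a b : ℝ}
    (hab : a ≤ b) (hf : LipschitzOnWith K f (Icc a b)) :
    ‖f b - f a‖ ≤ ∫ t in a..b, ‖deriv f t‖ := by
  have : CompleteSpace E := FiniteDimensional.complete ℝ E
  set w := f b - f a with hw
  have hg : LipschitzOnWith (‖innerSL ℝ w‖₊ * K) (fun t => inner ℝ w (f t)) (Icc a b) :=
    (innerSL ℝ w).lipschitz.comp_lipschitzOnWith hf
  rw [← uIcc_of_le hab] at hg
  have hac := hg.absolutelyContinuousOnInterval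
  have hint := hac.integral_deriv_eq_sub
  rw [← inner_sub_right, ← hw, real_inner_self_eq_norm_sq] at hint
  have hle : ∫ t in a..b, deriv (fun t => inner ℝ w (f t)) t ≤ ∫ t in a..b, ‖w‖ * ‖deriv f t‖ := by
    refine intervalIntegral.integral_mono_ae_restrict hab hac.intervalIntegrable_deriv
      ((hf.intervalIntegrable_norm_deriv hab).const_mul _) ?_
    rw [← Measure.restrict_congr_set Ioo_ae_eq_Icc]
    filter_upwards [ae_restrict_of_ae hf.ae_differentiableWithinAt_of_mem,
      ae_restrict_mem measurableSet_Ioo] with t hd ht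
    have hd' := (hd (Ioo_subset_Icc_self ht)).differentiableAt (Icc_mem_nhds ht.1 ht.2)
    have h := ((innerSL ℝ w).hasFDerivAt.comp_hasDerivAt t hd'.hasDerivAt).deriv
    have h' : deriv (fun t => inner ℝ w (f t)) t = inner ℝ w (deriv f t) := h
    rw [h']
    exact real_inner_le_norm _ _
  rw [hint, intervalIntegral.integral_const_mul, sq] at hle
  rcases (norm_nonneg w).eq_or_lt with h0 | h0
  · rw [← h0]
    exact intervalIntegral.integral_nonneg hab fun _ _ => norm_nonneg _
  · exact le_of_mul_le_mul_left hle h0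

/-- Constant-speed reparametrization: an arc may be replaced by one whose Lipschitz constant is
its length, defined and Lipschitz on the whole line. -/
theorem IsArc.exists_lipschitzWith_len {d : ℕ} {S : Set (X d)} {x0 x1 : X d} {ψ : ℝ → X d}
    (hψ : IsArc d S x0 x1 ψ) :
    ∃ χ : ℝ → X d, LipschitzWith (len d ψ).toNNReal χ ∧ (∀ t, χ t ∈ S) ∧ χ 0 = x0 ∧ χ 1 = x1 := by
  obtain ⟨⟨K, hK⟩, hS, h0, h1⟩ := hψ
  have hint := hK.intervalIntegrable_norm_deriv zero_le_one
  set g : ℝ → ℝ := fun t => ∫ s in (0:ℝ)..t, ‖deriv ψ s‖ with hg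
  have hg0 : g 0 = 0 := by simp [hg]
  have hg1 : g 1 = len d ψ := rfl
  have hlen : 0 ≤ len d ψ := intervalIntegral.integral_nonneg zero_le_one fun _ _ => norm_nonneg _
  have hcont : ContinuousOn g (Icc 0 1) := by
    have := intervalIntegral.continuousOn_primitive_interval' hint left_mem_uIcc
    rwa [uIcc_of_le zero_le_one] at this
  have hchord : ∀ s ∈ Icc (0:ℝ) 1, ∀ t ∈ Icc (0:ℝ) 1, dist (ψ s) (ψ t) ≤ dist (g s) (g t) := by
    intro s hs t ht
    wlog hst : t ≤ s generalizing s t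
    · rw [dist_comm, dist_comm (g s)]
      exact this t ht s hs (le_of_not_ge hst)
    have hsub : ∀ u ∈ Icc (0:ℝ) 1, IntervalIntegrable (fun r => ‖deriv ψ r‖) volume 0 u :=
      fun u hu => hint.mono_set <| by
        rw [uIcc_of_le hu.1, uIcc_of_le zero_le_one]; exact Icc_subset_Icc_right hu.2
    have hdiff : g s - g t = ∫ r in t..s, ‖deriv ψ r‖ :=
      intervalIntegral.integral_interval_sub_left (hsub s hs) (hsub t ht)
    rw [dist_eq_norm, Real.dist_eq, hdiff]
    exact ((hK.mono (Icc_subset_Icc ht.1 hs.2)).norm_sub_le_integral_norm_deriv hst).trans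
      (le_abs_self _)
  have hsurj : ∀ u ∈ Icc (0:ℝ) 1, ∃ t ∈ Icc (0:ℝ) 1, g t = u * len d ψ := fun u hu =>
    intermediate_value_Icc zero_le_one hcont
      ⟨by rw [hg0]; exact mul_nonneg hu.1 hlen, by rw [hg1]; exact mul_le_of_le_one_left hlen hu.2⟩
  choose! τ hτ hgτ using hsurj
  let p : ℝ → ℝ := fun t => projIcc 0 1 zero_le_one t
  have hp : ∀ t, p t ∈ Icc (0:ℝ) 1 := fun t => (projIcc 0 1 zero_le_one t).2
  have hpl : LipschitzWith 1 p := LipschitzWith.subtype_val _ |>.comp (LipschitzWith.projIcc _)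
    |>.weaken (by simp)
  have hp0 : p 0 = 0 := by simp [p]
  have hp1 : p 1 = 1 := by simp [p]
  have h01 : (0:ℝ) ∈ Icc (0:ℝ) 1 := left_mem_Icc.2 zero_le_one
  have h11 : (1:ℝ) ∈ Icc (0:ℝ) 1 := right_mem_Icc.2 zero_le_one
  refine ⟨fun t => ψ (τ (p t)), LipschitzWith.of_dist_le_mul fun s t => ?_,
    fun t => hS (hτ _ (hp t)), ?_, ?_⟩
  · calc dist (ψ (τ (p s))) (ψ (τ (p t))) ≤ dist (g (τ (p s))) (g (τ (p t))) :=
          hchord _ (hτ _ (hp s)) _ (hτ _ (hp t))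
      _ = len d ψ * dist (p s) (p t) := by
          rw [hgτ _ (hp s), hgτ _ (hp t), Real.dist_eq, Real.dist_eq, ← sub_mul, abs_mul,
            abs_of_nonneg hlen, mul_comm]
      _ ≤ (len d ψ).toNNReal * dist s t := by
          rw [Real.coe_toNNReal _ hlen]
          gcongr
          simpa using hpl.dist_le_mul s t
  · rw [← h0, ← dist_le_zero]
    refine (hchord _ (hτ _ (hp 0)) 0 h01).trans ?_
    rw [hgτ _ (hp 0), hp0, hg0, zero_mul, dist_self]
  · rw [← h1, ← dist_le_zero]
    refine (hchord _ (hτ _ (hp 1)) 1 h11).trans ?_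
    rw [hgτ _ (hp 1), hp1, hg1, one_mul, dist_self]

/-- The length of a Lipschitz arc is at most its Lipschitz constant. -/
theorem dSE_le_of_lipschitzWith_s7 {d : ℕ} {S : Set (X d)} {χ : ℝ → X d} {L : ℝ≥0}
    (hχ : LipschitzWith L χ) (hS : ∀ t, χ t ∈ S) : dSE d S (χ 0) (χ 1) ≤ L := by
  refine (iInf₂_le χ ⟨⟨L, hχ.lipschitzOnWith⟩, fun t _ => hS t, rfl, rfl⟩).trans ?_
  rw [← ENNReal.ofReal_coe_nnreal]
  refine ENNReal.ofReal_le_ofReal ?_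
  have h := intervalIntegral.norm_integral_le_of_norm_le_const (a := (0:ℝ)) (b := 1)
    (f := fun t => ‖deriv χ t‖) (C := L)
    fun t _ => by simpa using norm_deriv_le_of_lipschitz hχ
  exact (Real.le_norm_self _).trans (by simpa [len] using h)

/-- A sequence of uniformly Lipschitz curves that pass through convergent starting points and
approach a closed set has a limit curve inside that set. -/
theorem exists_lipschitzWith_limit {E : Type*} [MetricSpace E] [ProperSpace E] {S : Set E}
    (hS : IsClosed S) {x0 x1 : E} {L : ℝ≥0} {χ : ℕ → ℝ → E} {r : ℕ → ℝ≥0∞}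
    (hr : Filter.Tendsto r Filter.atTop (nhds 0)) (hχ : ∀ n, LipschitzWith L (χ n))
    (hχS : ∀ n t, Metric.infEDist (χ n t) S ≤ r n)
    (h0 : ∀ n, edist (χ n 0) x0 ≤ r n) (h1 : ∀ n, edist (χ n 1) x1 ≤ r n) :
    ∃ ξ : ℝ → E, LipschitzWith L ξ ∧ (∀ t, ξ t ∈ S) ∧ ξ 0 = x0 ∧ ξ 1 = x1 := by
  let U : Ultrafilter ℕ := Filter.hyperfilter ℕ
  have hU : (U : Filter ℕ) ≤ Filter.atTop := Nat.hyperfilter_le_atTop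
  have hrU := hr.mono_left hU
  have hx : ∀ {t x}, (∀ n, edist (χ n t) x ≤ r n) →
      Filter.Tendsto (fun n => χ n t) U (nhds x) := fun h =>
    tendsto_iff_edist_tendsto_0.2 <|
      tendsto_of_tendsto_of_tendsto_of_le_of_le tendsto_const_nhds hrU (fun _ => zero_le) h
  have hlim : ∀ t, ∃ y, Filter.Tendsto (fun n => χ n t) U (nhds y) := by
    intro t
    have hmem : ∀ᶠ n in (U : Filter ℕ), χ n t ∈ Metric.closedBall x0 (L * dist t 0 + 1) := by
      filter_upwards [(hx h0).eventually (Metric.closedBall_mem_nhds x0 one_pos)] with n hn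
      exact (dist_triangle _ (χ n 0) _).trans (add_le_add ((hχ n).dist_le_mul t 0) hn)
    obtain ⟨y, -, hy⟩ := (isCompact_closedBall x0 (L * dist t 0 + 1)).ultrafilter_le_nhds
      (U.map fun n => χ n t) (Filter.le_principal_iff.2 hmem)
    exact ⟨y, hy⟩
  choose ξ hξ using hlim
  refine ⟨ξ, fun s t => ?_, fun t => ?_, ?_, ?_⟩
  · exact le_of_tendsto ((hξ s).edist (hξ t)) (Filter.Eventually.of_forall fun n => hχ n s t)
  · rw [Metric.mem_iff_infEDist_zero_of_closed hS]
    exact nonpos_iff_eq_zero.1 <| le_of_tendsto_of_tendsto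
      ((Metric.continuous_infEDist.tendsto _).comp (hξ t)) hrU
      (Filter.Eventually.of_forall fun n => hχS n t)
  · exact tendsto_nhds_unique (hξ 0) (hx h0)
  · exact tendsto_nhds_unique (hξ 1) (hx h1)

/-- `μ` is lower semicontinuous on `𝒮` w.r.t. the Hausdorff metric:
if `Sseq n ∈ 𝒮` converges to `S ∈ 𝒮` in Hausdorff distance, then
`liminf μ(Sseq n) ≥ μ(S)`. -/
theorem stmt7 (d : ℕ) (Sseq : ℕ → Set (X d)) (hSn : ∀ m, MemS d (Sseq m))
    (S : Set (X d)) (hS : MemS d S)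
    (hconv : Filter.Tendsto (fun m => EMetric.hausdorffEdist (Sseq m) S)
      Filter.atTop (nhds 0)) :
    muE d S ≤ Filter.liminf (fun m => muE d (Sseq m)) Filter.atTop := by
  refine le_of_forall_gt_imp_ge_of_dense fun L hL => ?_
  induction L using ENNReal.recTopCoe with
  | top => exact le_top
  | coe L =>
  refine iSup₂_le fun x0 hx0 => iSup₂_le fun x1 hx1 => ?_
  have hfreq := Filter.frequently_lt_of_liminf_lt (by isBoundedDefault) hL
  have hstep : ∀ n : ℕ, ∃ χ : ℝ → X d, LipschitzWith L χ ∧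
      (∀ t, Metric.infEDist (χ t) S ≤ (n : ℝ≥0∞)⁻¹) ∧
      edist (χ 0) x0 ≤ (n : ℝ≥0∞)⁻¹ ∧ edist (χ 1) x1 ≤ (n : ℝ≥0∞)⁻¹ := by
    intro n
    have hpos : (0 : ℝ≥0∞) < (n : ℝ≥0∞)⁻¹ := ENNReal.inv_pos.2 (ENNReal.natCast_ne_top n)
    obtain ⟨m, hmL, hm⟩ := (hfreq.and_eventually (hconv.eventually_lt_const hpos)).exists
    change Metric.hausdorffEDist (Sseq m) S < _ at hm
    have hm' := Metric.hausdorffEDist_comm.trans_lt hm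
    obtain ⟨y0, hy0, hd0⟩ := Metric.exists_edist_lt_of_hausdorffEDist_lt hx0 hm'
    obtain ⟨y1, hy1, hd1⟩ := Metric.exists_edist_lt_of_hausdorffEDist_lt hx1 hm'
    have hlt : dSE d (Sseq m) y0 y1 < L := lt_of_le_of_lt
      ((le_iSup₂ (f := fun y1 _ => dSE d (Sseq m) y0 y1) y1 hy1).trans
        (le_iSup₂ (f := fun y0 _ => ⨆ y1 ∈ Sseq m, dSE d (Sseq m) y0 y1) y0 hy0)) hmL
    obtain ⟨ψ, hψ, hψL⟩ : ∃ ψ, ∃ _ : IsArc d (Sseq m) y0 y1 ψ, ENNReal.ofReal (len d ψ) < L := by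
      simpa only [dSE, iInf_lt_iff] using hlt
    obtain ⟨χ, hχ, hχS, h0, h1⟩ := hψ.exists_lipschitzWith_len
    refine ⟨χ, hχ.weaken (ENNReal.coe_lt_coe.1 hψL).le, fun t =>
      (Metric.infEDist_le_hausdorffEDist_of_mem (hχS t)).trans hm.le, ?_, ?_⟩
    · rw [h0, edist_comm]; exact hd0.le
    · rw [h1, edist_comm]; exact hd1.le
  choose χ hχ hχS h0 h1 using hstep
  obtain ⟨ξ, hξ, hξS, rfl, rfl⟩ := exists_lipschitzWith_limit hS.1.isClosed
    ENNReal.tendsto_inv_nat_nhds_zero hχ hχS h0 h1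
  exact dSE_le_of_lipschitzWith_s7 hξ hξS

end
end

section
/- Let f : X → X be a bijection with f and f⁻¹ Lipschitz, and let S ⊆ X be a convex set such that f(S) is also convex. Then f maps the relative interior of S onto the relative interior of f(S), i.e. f(ri(S)) = ri(f(S)). Consequently, for S ∈ 𝒮 the set ri(S) := φ⁻¹(ri(φ(S))) does not depend on the choice of the bijection φ with φ, φ⁻¹ Lipschitz and φ(S) convex. -/
open Set MeasureTheory
open scoped NNReal ENNReal Classical

noncomputable section

/-- The relative interior `ri(S) := φ⁻¹(ri(φ(S)))` of a set `S` admitting an admissible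
change of variables `φ` (independent of the choice of `φ`); junk value `∅` otherwise. -/
def relInt (d : ℕ) (S : Set (X d)) : Set (X d) :=
  if h : ∃ φ : X d ≃ X d, Admissible d φ S then
    h.choose.symm '' intrinsicInterior ℝ (h.choose '' S)
  else ∅

/-- The relative boundary `r∂(S) := S \ ri(S)`. -/
def relBd (d : ℕ) (S : Set (X d)) : Set (X d) := S \ relInt d S

section BilipschitzRelativeInterior

open Module Filter Topology Asymptotics

/-- The radial retraction of a real vector space onto the frontier of `C` given by the gauge
of `C`. -/
def radialRetraction {F : Type*} [AddCommGroup F] [Module ℝ F] (C : Set F) (z : F) : F :=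
  (gauge C z)⁻¹ • z

section

variable {E F : Type*} [NormedAddCommGroup E] [NormedSpace ℝ E]
  [NormedAddCommGroup F] [NormedSpace ℝ F] {C : Set F}

lemma gauge_radialRetraction {z : F} (hz : 0 < gauge C z) :
    gauge C (radialRetraction C z) = 1 := by
  rw [radialRetraction, gauge_smul_of_nonneg (by positivity), smul_eq_mul, inv_mul_cancel₀ hz.ne']

lemma radialRetraction_mem (hC : Convex ℝ C) (hcl : IsClosed C) (h0 : C ∈ 𝓝 0) {z : F}
    (hz : 0 < gauge C z) : radialRetraction C z ∈ C := by
  have h := (gauge_le_one_iff_mem_closure hC h0).1 (gauge_radialRetraction hz).le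
  rwa [hcl.closure_eq] at h

lemma radialRetraction_smul {s : ℝ} (hs : 0 < s) (z : F) :
    radialRetraction C (s • z) = radialRetraction C z := by
  rw [radialRetraction, radialRetraction, gauge_smul_of_nonneg hs.le, smul_smul, smul_eq_mul,
    mul_inv, mul_right_comm, inv_mul_cancel₀ hs.ne', one_mul]

lemma radialRetraction_of_gauge_eq_one {z : F} (hz : gauge C z = 1) :
    radialRetraction C z = z := by
  simp [radialRetraction, hz]

lemma exists_lipschitzOnWith_radialRetraction (hC : Convex ℝ C) (h0 : C ∈ 𝓝 0) {y : F}
    (hy : gauge C y = 1) :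
    ∃ K : ℝ≥0, ∃ U ∈ 𝓝 y, (∀ z ∈ U, 0 < gauge C z) ∧
      LipschitzOnWith K (radialRetraction C) U := by
  obtain ⟨M, hM⟩ := hC.lipschitz_gauge h0
  have hγ : ∀ᶠ z in 𝓝 y, 1 / 2 < gauge C z :=
    (continuous_gauge hC h0).continuousAt.eventually_const_lt (by rw [hy]; norm_num)
  have hb : ∀ᶠ z in 𝓝 y, ‖z‖ < ‖y‖ + 1 :=
    continuous_norm.continuousAt.eventually_lt_const (by linarith)
  refine ⟨2 + 4 * M * (‖y‖₊ + 1), _, hγ.and hb, fun z hz ↦ by linarith [hz.1], ?_⟩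
  refine LipschitzOnWith.of_dist_le_mul fun z hz w hw ↦ ?_
  obtain ⟨hz1, hz2⟩ := hz
  obtain ⟨hw1, hw2⟩ := hw
  have hz0 : 0 < gauge C z := by linarith
  have hw0 : 0 < gauge C w := by linarith
  have hMzw : |gauge C z - gauge C w| ≤ M * ‖z - w‖ := by
    simpa [Real.dist_eq, dist_eq_norm] using hM.dist_le_mul z w
  have hzi : (gauge C z)⁻¹ ≤ 2 := by
    rw [inv_le_comm₀ hz0 (by norm_num)]; linarith
  have hwi : (gauge C w)⁻¹ ≤ 2 := by
    rw [inv_le_comm₀ hw0 (by norm_num)]; linarith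
  have hinv : |(gauge C z)⁻¹ - (gauge C w)⁻¹| ≤ 4 * M * ‖z - w‖ := by
    have : (gauge C z)⁻¹ - (gauge C w)⁻¹
        = ((gauge C z)⁻¹ * (gauge C w)⁻¹) * (gauge C w - gauge C z) := by field_simp
    rw [this, abs_mul, abs_of_pos (by positivity), abs_sub_comm]
    calc _ ≤ (2 * 2) * (M * ‖z - w‖) := by gcongr
      _ = _ := by ring
  have hdec : radialRetraction C z - radialRetraction C w
      = (gauge C z)⁻¹ • (z - w) + ((gauge C z)⁻¹ - (gauge C w)⁻¹) • w := by
    simp only [radialRetraction]; module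
  rw [dist_eq_norm, dist_eq_norm, hdec]
  calc _ ≤ (gauge C z)⁻¹ * ‖z - w‖ + |(gauge C z)⁻¹ - (gauge C w)⁻¹| * ‖w‖ := by
        refine (norm_add_le _ _).trans_eq ?_
        rw [norm_smul, norm_smul, Real.norm_eq_abs, Real.norm_eq_abs, abs_of_pos (by positivity)]
    _ ≤ 2 * ‖z - w‖ + (4 * M * ‖z - w‖) * (‖y‖ + 1) := by gcongr
    _ = _ := by push_cast; ring

variable [FiniteDimensional ℝ E] [FiniteDimensional ℝ F]

lemma exists_hasFDerivAt_comp_radialRetraction (hC : Convex ℝ C) (h0 : C ∈ 𝓝 0) {y : F}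
    (hy : gauge C y = 1) {K : ℝ≥0} {g : F → E} (hg : LipschitzWith K g) {O : Set E}
    (hO : O ∈ 𝓝 (g y)) :
    ∃ b : F, ∃ L : F →L[ℝ] E, gauge C b = 1 ∧ g b ∈ O ∧
      HasFDerivAt (g ∘ radialRetraction C) L b := by
  borelize F
  obtain ⟨K', U, hU, hpos, hlip⟩ := exists_lipschitzOnWith_radialRetraction hC h0 hy
  have hlip' : LipschitzOnWith (K * K') (g ∘ radialRetraction C) U := hg.comp_lipschitzOnWith hlip
  have hcont : ContinuousAt (g ∘ radialRetraction C) y := hlip'.continuousOn.continuousAt hU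
  have hO' : (g ∘ radialRetraction C) ⁻¹' O ∈ 𝓝 y := by
    apply hcont.preimage_mem_nhds
    simpa [radialRetraction_of_gauge_eq_one hy] using hO
  have hne : (interior (U ∩ (g ∘ radialRetraction C) ⁻¹' O)).Nonempty :=
    ⟨y, mem_interior_iff_mem_nhds.2 (inter_mem hU hO')⟩
  obtain ⟨p, hpd, hpU⟩ :=
    (Measure.dense_of_ae (hlip'.ae_differentiableWithinAt_of_mem
      (μ := Measure.addHaar))).exists_mem_open isOpen_interior hne
  have hpU' := interior_subset hpU
  have hγ := hpos p hpU'.1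
  have hUp : U ∈ 𝓝 p := mem_of_superset (isOpen_interior.mem_nhds hpU)
    (interior_subset.trans inter_subset_left)
  have hd : DifferentiableAt ℝ (g ∘ radialRetraction C) p := (hpd hpU'.1).differentiableAt hUp
  have hp : p = gauge C p • radialRetraction C p := by
    rw [radialRetraction, smul_smul, mul_inv_cancel₀ hγ.ne', one_smul]
  have hcomp : g ∘ radialRetraction C = (g ∘ radialRetraction C) ∘ fun z ↦ gauge C p • z := by
    ext z; simp [radialRetraction_smul hγ]
  have hd' : DifferentiableAt ℝ (g ∘ radialRetraction C) (radialRetraction C p) := by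
    rw [hcomp]
    refine DifferentiableAt.comp _ ?_ (by fun_prop)
    rwa [← hp]
  exact ⟨radialRetraction C p, _, gauge_radialRetraction hγ, hpU'.2, hd'.hasFDerivAt⟩

omit [FiniteDimensional ℝ E] in
lemma ker_fderiv_comp_radialRetraction (hC : Convex ℝ C) (hcl : IsClosed C) (h0 : C ∈ 𝓝 0)
    {K : ℝ≥0} {f : E → F} {g : F → E} (hf : LipschitzWith K f) (hfg : LeftInvOn f g C) {b : F}
    (hb : gauge C b = 1) {L : F →L[ℝ] E} (hL : HasFDerivAt (g ∘ radialRetraction C) L b) :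
    LinearMap.ker (L : F →ₗ[ℝ] E) = Submodule.span ℝ {b} := by
  have hline (w : F) : HasDerivAt (fun t : ℝ ↦ g (radialRetraction C (b + t • w))) (L w) 0 := by
    have h1 : HasDerivAt (fun t : ℝ ↦ b + t • w) w 0 := by
      simpa using ((hasDerivAt_id (0 : ℝ)).smul_const w).const_add b
    exact HasFDerivAt.comp_hasDerivAt (f := fun t : ℝ ↦ b + t • w) 0 (by simpa using hL) h1
  apply le_antisymm
  · intro w hw
    by_contra hwb
    obtain ⟨φ, hφw, hφ⟩ := Submodule.exists_le_ker_of_notMem hwb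
    have hφb : φ b = 0 := hφ (Submodule.mem_span_singleton_self b)
    have hw0 : L w = 0 := hw
    have h1 := (hasDerivAt_iff_isLittleO.1 (hline w))
    simp only [zero_smul, add_zero, hw0, smul_zero, sub_zero] at h1
    have hcont : ContinuousAt (fun t : ℝ ↦ gauge C (b + t • w)) 0 :=
      ((continuous_gauge hC h0).comp (by fun_prop)).continuousAt
    have hpos : ∀ᶠ t : ℝ in 𝓝 0, 0 < gauge C (b + t • w) :=
      hcont.eventually_const_lt (by simp [hb])
    let φ' : F →L[ℝ] ℝ := LinearMap.toContinuousLinearMap φ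
    have h2 : (fun t : ℝ ↦ radialRetraction C (b + t • w) - b) =o[𝓝 0] fun t : ℝ ↦ t := by
      refine IsBigO.trans_isLittleO (IsBigO.of_bound K ?_) h1
      filter_upwards [hpos] with t ht
      have h := hf.dist_le_mul (g (radialRetraction C (b + t • w))) (g (radialRetraction C b))
      rw [hfg (radialRetraction_mem hC hcl h0 ht),
        hfg (radialRetraction_mem hC hcl h0 (hb ▸ one_pos)),
        radialRetraction_of_gauge_eq_one hb, dist_eq_norm, dist_eq_norm] at h
      rwa [radialRetraction_of_gauge_eq_one hb]
    have h3 : (fun t : ℝ ↦ φ' (radialRetraction C (b + t • w) - b)) =o[𝓝 0] fun t : ℝ ↦ t :=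
      (φ'.isBigO_comp _ _).trans_isLittleO h2
    have h4 := (hcont.tendsto.isBigO_one ℝ).mul_isLittleO h3
    have h5 : (fun t : ℝ ↦ t * φ w) =o[𝓝 0] fun t : ℝ ↦ t := by
      refine h4.congr' ?_ (by simp)
      filter_upwards [hpos] with t ht
      have : φ' b = 0 := hφb
      rw [map_sub, this, radialRetraction, map_smul, map_add, map_smul, this]
      simp only [smul_eq_mul, zero_add, sub_zero]
      rw [mul_inv_cancel_left₀ ht.ne']
      rfl
    have h6 : HasDerivAt (fun t : ℝ ↦ t * φ w) 0 0 := by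
      rw [hasDerivAt_iff_isLittleO]; simpa using h5
    have h7 : HasDerivAt (fun t : ℝ ↦ t * φ w) (φ w) 0 := hasDerivAt_mul_const _
    exact hφw (h7.unique h6)
  · rw [Submodule.span_singleton_le_iff_mem, LinearMap.mem_ker]
    refine (hline b).unique (HasDerivAt.congr_of_eventuallyEq
      (hasDerivAt_const 0 (g (radialRetraction C b))) ?_)
    filter_upwards [lt_mem_nhds (show (-1 : ℝ) < 0 by norm_num)] with t ht
    rw [show b + t • b = (1 + t) • b by module, radialRetraction_smul (by linarith)]

lemma exists_functional_of_ker_eq_span (hdim : finrank ℝ E = finrank ℝ F) {L : F →L[ℝ] E} {b : F}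
    (hb : b ≠ 0) (hL : LinearMap.ker (L : F →ₗ[ℝ] E) = Submodule.span ℝ {b}) :
    ∃ (l : E →L[ℝ] ℝ) (n : E) (R : E →L[ℝ] F),
      l n = 1 ∧ (∀ v, l (L v) = 0) ∧ ∀ e, l e = 0 → L (R e) = e := by
  set L' : F →ₗ[ℝ] E := (L : F →ₗ[ℝ] E)
  have hker : finrank ℝ (LinearMap.ker L') = 1 := by rw [hL, finrank_span_singleton hb]
  have hrank := LinearMap.finrank_range_add_finrank_ker L'
  have hlt : LinearMap.range L' < ⊤ := by
    apply Submodule.lt_top_of_finrank_lt_finrank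
    omega
  obtain ⟨φ, hφ0, hφ⟩ := Submodule.exists_le_ker_of_lt_top _ hlt
  have hφk := Module.Dual.finrank_ker_add_one_of_ne_zero hφ0
  have heq : LinearMap.range L' = LinearMap.ker φ :=
    Submodule.eq_of_le_of_finrank_le hφ (by omega)
  obtain ⟨m, hm⟩ : ∃ m, φ m ≠ 0 := by
    by_contra! h
    exact hφ0 (LinearMap.ext h)
  obtain ⟨R₀, hR₀⟩ := L'.rangeRestrict.exists_rightInverse_of_surjective L'.range_rangeRestrict
  obtain ⟨R, hR⟩ := R₀.exists_extend
  refine ⟨LinearMap.toContinuousLinearMap φ, (φ m)⁻¹ • m, LinearMap.toContinuousLinearMap R,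
    by simp [hm], fun v ↦ hφ (LinearMap.mem_range_self L' v), fun e he ↦ ?_⟩
  have hmem : e ∈ LinearMap.range L' := by rw [heq]; exact he
  have h1 : R e = R₀ ⟨e, hmem⟩ := LinearMap.congr_fun hR ⟨e, hmem⟩
  have h2 := congrArg Subtype.val (LinearMap.congr_fun hR₀ ⟨e, hmem⟩)
  change L' (R e) = e
  rw [h1]
  exact h2

/-- A bi-Lipschitz bijection between two closed sets of finite-dimensional spaces of the same
dimension, the target being convex, maps interior points to interior points. -/
lemma map_mem_interior_of_bilipschitz (hdim : finrank ℝ E = finrank ℝ F) {A : Set E}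
    (hC : Convex ℝ C) (hcl : IsClosed C) (h0 : C ∈ 𝓝 0) {K : ℝ≥0} {f : E → F} {g : F → E}
    (hf : LipschitzWith K f) (hg : LipschitzWith K g) (hfA : MapsTo f A C)
    (hfg : LeftInvOn f g C) (hgf : LeftInvOn g f A) {x : E} (hx : x ∈ interior A) :
    f x ∈ interior C := by
  by_contra hfx
  have hxA := interior_subset hx
  have hy : gauge C (f x) = 1 := by
    refine le_antisymm (gauge_le_one_of_mem (hfA hxA)) ?_
    rw [← gauge_lt_one_iff_mem_interior hC h0] at hfx
    exact not_lt.1 hfx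
  obtain ⟨b, L, hb, hbA, hL⟩ := exists_hasFDerivAt_comp_radialRetraction hC h0 hy hg
    (O := interior A) (by rw [hgf hxA]; exact isOpen_interior.mem_nhds hx)
  have hb0 : b ≠ 0 := by
    rintro rfl
    simp at hb
  obtain ⟨l, n, R, hln, hlL, hLR⟩ := exists_functional_of_ker_eq_span hdim hb0
    (ker_fderiv_comp_radialRetraction hC hcl h0 hf hfg hb hL)
  obtain ⟨M, hM⟩ := hC.lipschitz_gauge h0
  have hbC : b ∈ C := by
    rw [← radialRetraction_of_gauge_eq_one hb]
    exact radialRetraction_mem hC hcl h0 (hb ▸ one_pos)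
  have hfq : f (g b) = b := hfg hbC
  have hfK (u v) : ‖f u - f v‖ ≤ K * ‖u - v‖ := by
    simpa [dist_eq_norm] using hf.dist_le_mul u v
  have hgK (u v) : ‖g u - g v‖ ≤ K * ‖u - v‖ := by
    simpa [dist_eq_norm] using hg.dist_le_mul u v
  have hMγ (u v) : |gauge C u - gauge C v| ≤ M * ‖u - v‖ := by
    simpa [dist_eq_norm, Real.dist_eq] using hM.dist_le_mul u v
  set Q : ℝ := 4 * ‖l‖ * K * (‖b‖ + 1) with hQ
  set P : ℝ := Q * (M * (K * (‖R‖ * (K * (K * ‖n‖))))) with hP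
  have hQ0 : 0 ≤ Q := by positivity
  have hP0 : 0 ≤ P := by positivity
  have hS0 : 0 ≤ ‖l‖ * (K * ‖n‖) := by positivity
  obtain ⟨ε, hε0, hε⟩ : ∃ ε : ℝ, 0 < ε ∧ ε * (1 + P + ‖l‖ * (K * ‖n‖)) = 1 / 2 :=
    ⟨1 / 2 / (1 + P + ‖l‖ * (K * ‖n‖)), by positivity, by field_simp⟩
  have hεl : ε * (‖l‖ * (K * ‖n‖)) ≤ 1 / 2 := by nlinarith
  have hεP : ε * P ≤ 1 / 2 := by nlinarith
  have hev1 : ∀ᶠ z in 𝓝 b, ‖g (radialRetraction C z) - g b - L (z - b)‖ ≤ ε * ‖z - b‖ := by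
    simpa [radialRetraction_of_gauge_eq_one hb] using (hasFDerivAt_iff_isLittleO.1 hL).def hε0
  have hev2 : ∀ᶠ z in 𝓝 b, 1 / 2 < gauge C z :=
    (continuous_gauge hC h0).continuousAt.eventually_const_lt (by rw [hb]; norm_num)
  have hev3 : ∀ᶠ z in 𝓝 b, ‖z‖ < ‖b‖ + 1 :=
    continuous_norm.continuousAt.eventually_lt_const (by linarith)
  obtain ⟨δ, hδ, hball⟩ := Metric.eventually_nhds_iff.1 (hev1.and (hev2.and hev3))
  have hsmall (D : ℝ) : ∀ᶠ r : ℝ in 𝓝 0, D * r < δ :=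
    (show ContinuousAt (fun r : ℝ ↦ D * r) 0 by fun_prop).eventually_lt_const (by simpa)
  have hnear (s : ℝ) : ∀ᶠ r : ℝ in 𝓝 0, g b + (s * r) • n ∈ A := by
    have hc : ContinuousAt (fun r : ℝ ↦ g b + (s * r) • n) 0 := by fun_prop
    exact hc.preimage_mem_nhds (by simpa using mem_interior_iff_mem_nhds.1 hbA)
  obtain ⟨r, ⟨hr1, hr2, hr3, hr4⟩, hr⟩ := (((hsmall (K * ‖n‖)).and
    ((hsmall (‖R‖ * (K * (K * ‖n‖)))).and ((hnear 1).and (hnear (-1))))).filter_mono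
      nhdsWithin_le_nhds |>.and (self_mem_nhdsWithin (s := Ioi (0 : ℝ)))).exists
  replace hr : 0 < r := hr
  have hdist (s : ℝ) (hs : |s| = 1) : ‖f (g b + (s * r) • n) - b‖ ≤ K * ‖n‖ * r := by
    calc _ ≤ K * ‖g b + (s * r) • n - g b‖ := by simpa only [hfq] using hfK (g b + (s * r) • n) (g b)
      _ = _ := by
        rw [add_sub_cancel_left, norm_smul, Real.norm_eq_abs, abs_mul, hs, abs_of_pos hr]; ring
  have hdepth (s : ℝ) (hs : |s| = 1) (hsA : g b + (s * r) • n ∈ A) :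
      r ≤ Q * (1 - gauge C (f (g b + (s * r) • n))) := by
    have hcb := hdist s hs
    have hgc : g (f (g b + (s * r) • n)) = g b + (s * r) • n := hgf hsA
    have hc1 : gauge C (f (g b + (s * r) • n)) ≤ 1 := gauge_le_one_of_mem (hfA hsA)
    set c := f (g b + (s * r) • n)
    obtain ⟨h1, h2, h3⟩ := hball (y := c) (by rw [dist_eq_norm]; linarith)
    have hlin : l (g c - g (radialRetraction C c))
        = s * r - l (g (radialRetraction C c) - g b - L (c - b)) := by
      rw [hgc]
      simp only [map_sub, map_add, map_smul, hln, hlL, smul_eq_mul]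
      ring
    have hup : |l (g (radialRetraction C c) - g b - L (c - b))| ≤ r / 2 := by
      calc _ ≤ ‖l‖ * (ε * (K * ‖n‖ * r)) := by
            refine (l.le_opNorm _).trans ?_
            gcongr
            exact h1.trans (by gcongr)
        _ = ε * (‖l‖ * (K * ‖n‖)) * r := by ring
        _ ≤ 1 / 2 * r := by gcongr
        _ = r / 2 := by ring
    have hlow : r / 2 ≤ |l (g c - g (radialRetraction C c))| := by
      rw [hlin]
      have h4 := abs_sub_abs_le_abs_sub (s * r) (l (g (radialRetraction C c) - g b - L (c - b)))
      rw [abs_mul, hs, one_mul, abs_of_pos hr] at h4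
      linarith
    have hγi : (gauge C c)⁻¹ ≤ 2 := by
      rw [inv_le_comm₀ (by linarith) (by norm_num)]; linarith
    have hret : ‖c - radialRetraction C c‖ ≤ 2 * (1 - gauge C c) * (‖b‖ + 1) := by
      have : c - radialRetraction C c = -(((gauge C c)⁻¹ * (1 - gauge C c)) • c) := by
        have h5 : (gauge C c)⁻¹ * (1 - gauge C c) = (gauge C c)⁻¹ - 1 := by
          have : gauge C c ≠ 0 := by linarith
          field_simp
        rw [h5, radialRetraction]; module
      have h6 : 0 ≤ 1 - gauge C c := by linarith
      have h7 : 0 ≤ (gauge C c)⁻¹ := by rw [inv_nonneg]; linarith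
      rw [this, norm_neg, norm_smul, Real.norm_eq_abs, abs_of_nonneg (by positivity)]
      gcongr
    have hmain : |l (g c - g (radialRetraction C c))|
        ≤ ‖l‖ * (K * (2 * (1 - gauge C c) * (‖b‖ + 1))) := by
      refine (l.le_opNorm _).trans ?_
      gcongr
      exact (hgK _ _).trans (by gcongr)
    rw [hQ]
    linarith
  have hpos := hdepth 1 (by simp) hr3
  have hneg := hdepth (-1) (by simp) hr4
  have hposb := hdist 1 (by simp)
  have hnegb := hdist (-1) (by simp)
  have hposC := hfA hr3
  have hnegC := hfA hr4
  have hposg := hgf hr3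
  have hnegg := hgf hr4
  set c₁ := f (g b + (1 * r) • n)
  set c₂ := f (g b + (-1 * r) • n)
  obtain ⟨c, hc, hlc⟩ : ∃ c ∈ segment ℝ c₂ c₁, l (g c - g b) = 0 := by
    have hcont : ContinuousOn (fun c ↦ l (g c - g b)) (segment ℝ c₂ c₁) :=
      (l.continuous.comp (hg.continuous.sub continuous_const)).continuousOn
    refine (convex_segment c₂ c₁).isPreconnected.intermediate_value
      (left_mem_segment ℝ c₂ c₁) (right_mem_segment ℝ c₂ c₁) hcont ⟨?_, ?_⟩
    · rw [hnegg]; simp [hln, hr.le]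
    · rw [hposg]; simp [hln, hr.le]
  have hcC : c ∈ C := hC.segment_subset hnegC hposC hc
  have hcb : ‖c - b‖ ≤ K * ‖n‖ * r := by
    have := (convex_closedBall b (K * ‖n‖ * r)).segment_subset
      (by rwa [mem_closedBall_iff_norm]) (by rwa [mem_closedBall_iff_norm]) hc
    rwa [mem_closedBall_iff_norm] at this
  have hcr : r ≤ Q * (1 - gauge C c) := by
    obtain ⟨s, t, hs, ht, hst, rfl⟩ := hc
    have hγ : gauge C (s • c₂ + t • c₁) ≤ s * gauge C c₂ + t * gauge C c₁ := by
      refine (gauge_add_le hC (absorbent_nhds_zero h0) _ _).trans_eq ?_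
      rw [gauge_smul_of_nonneg hs, gauge_smul_of_nonneg ht, smul_eq_mul, smul_eq_mul]
    calc r = s * r + t * r := by rw [← add_mul, hst, one_mul]
      _ ≤ s * (Q * (1 - gauge C c₂)) + t * (Q * (1 - gauge C c₁)) := by gcongr
      _ = Q * (1 - (s * gauge C c₂ + t * gauge C c₁)) := by linear_combination Q * hst
      _ ≤ _ := by gcongr
  set v := R (g c - g b) with hv
  have hLv : L v = g c - g b := hLR _ hlc
  have hvn : ‖v‖ ≤ ‖R‖ * (K * (K * ‖n‖)) * r := by
    calc ‖v‖ ≤ ‖R‖ * (K * (K * ‖n‖ * r)) := by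
          refine (R.le_opNorm _).trans ?_
          gcongr
          exact (hgK _ _).trans (by gcongr)
      _ = _ := by ring
  obtain ⟨h1, h2, -⟩ := hball (y := b + v) (by rw [dist_eq_norm, add_sub_cancel_left]; linarith)
  rw [add_sub_cancel_left, hLv, sub_sub_sub_cancel_right] at h1
  have hγ0 : 0 < gauge C (b + v) := by linarith
  have hclose : 1 - gauge C c ≤ M * (K * (ε * (‖R‖ * (K * (K * ‖n‖)) * r))) := by
    calc 1 - gauge C c ≤ |gauge C (radialRetraction C (b + v)) - gauge C c| := by
          rw [gauge_radialRetraction hγ0]; exact le_abs_self _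
      _ ≤ M * ‖f (g (radialRetraction C (b + v))) - f (g c)‖ := by
          rw [hfg (radialRetraction_mem hC hcl h0 hγ0), hfg hcC]; exact hMγ _ _
      _ ≤ _ := by
          gcongr
          refine (hfK _ _).trans ?_
          gcongr
          exact h1.trans (by gcongr)
  have hfinal : r ≤ 1 / 2 * r := by
    calc r ≤ Q * (1 - gauge C c) := hcr
      _ ≤ Q * (M * (K * (ε * (‖R‖ * (K * (K * ‖n‖)) * r)))) := by gcongr
      _ = ε * P * r := by rw [hP]; ring
      _ ≤ 1 / 2 * r := by gcongr
  linarith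

end

section

variable {E F : Type*} [NormedAddCommGroup E] [NormedSpace ℝ E] [FiniteDimensional ℝ E]
  [NormedAddCommGroup F] [NormedSpace ℝ F] [FiniteDimensional ℝ F]

omit [FiniteDimensional ℝ E] in
lemma intrinsicInterior_eq_interior_of_affineSpan_eq_top {T : Set E}
    (hT : affineSpan ℝ T = ⊤) : intrinsicInterior ℝ T = interior T := by
  have huniv : (affineSpan ℝ T : Set E) = univ := by rw [hT, AffineSubspace.top_coe]
  have hopen : IsOpen (affineSpan ℝ T : Set E) := huniv ▸ isOpen_univ
  have hemb : IsOpenEmbedding ((↑) : affineSpan ℝ T → E) := hopen.isOpenEmbedding_subtypeVal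
  rw [intrinsicInterior, ← hemb.isOpenMap.preimage_interior_eq_interior_preimage hemb.continuous,
    image_preimage_eq_of_subset]
  rw [Subtype.range_coe]
  exact huniv ▸ subset_univ _

omit [FiniteDimensional ℝ E] in
lemma intrinsicInterior_eq_image_interior_direction {T : Set E} {p : E} (hp : p ∈ T) :
    intrinsicInterior ℝ T = (fun v : (affineSpan ℝ T).direction ↦ (v : E) + p) ''
      interior ((fun v : (affineSpan ℝ T).direction ↦ (v : E) + p) ⁻¹' T) := by
  let φ : (affineSpan ℝ T).direction →ᵃⁱ[ℝ] E :=
    (AffineIsometryEquiv.vaddConst ℝ p).toAffineIsometry.comp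
      (affineSpan ℝ T).direction.subtypeₗᵢ.toAffineIsometry
  change intrinsicInterior ℝ T = φ '' interior (φ ⁻¹' T)
  have himg : φ '' (φ ⁻¹' T) = T := by
    refine image_preimage_eq_of_subset fun x hx ↦ ?_
    exact ⟨⟨x - p, AffineSubspace.vsub_mem_direction (subset_affineSpan ℝ T hx)
      (subset_affineSpan ℝ T hp)⟩, sub_add_cancel x p⟩
  have hspan : affineSpan ℝ (φ ⁻¹' T) = ⊤ := by
    rw [eq_top_iff]
    intro v _
    have hv : φ v ∈ (affineSpan ℝ (φ ⁻¹' T)).map φ.toAffineMap := by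
      rw [AffineSubspace.map_span, AffineIsometry.coe_toAffineMap, himg]
      exact AffineSubspace.vadd_mem_of_mem_direction v.2 (subset_affineSpan ℝ T hp)
    obtain ⟨a, ha, hav⟩ := hv
    rwa [← φ.injective hav]
  rw [← intrinsicInterior_eq_interior_of_affineSpan_eq_top hspan,
    ← AffineIsometry.intrinsicInterior_image,
    himg]

/-- A bi-Lipschitz bijection mapping a set to a convex set maps the relative interior into
the relative interior. -/
lemma image_intrinsicInterior_subset_of_bilipschitz {K : ℝ≥0} (f : E ≃ F)
    (hf : LipschitzWith K f) (hg : LipschitzWith K f.symm) {S : Set E}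
    (hfS : Convex ℝ (f '' S)) :
    f '' intrinsicInterior ℝ S ⊆ intrinsicInterior ℝ (f '' S) := by
  rintro _ ⟨x, hx, rfl⟩
  obtain ⟨y, hy⟩ := Set.Nonempty.intrinsicInterior hfS ⟨f x, mem_image_of_mem f
    (intrinsicInterior_subset hx)⟩
  obtain ⟨p, hp, rfl⟩ := intrinsicInterior_subset hy
  have hfp : f p ∈ f '' S := mem_image_of_mem f hp
  rw [intrinsicInterior_eq_image_interior_direction hp] at hx
  rw [intrinsicInterior_eq_image_interior_direction hfp] at hy ⊢
  set V := (affineSpan ℝ S).direction with hV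
  set W := (affineSpan ℝ (f '' S)).direction with hW
  obtain ⟨P, hP⟩ := Submodule.ClosedComplemented.of_finiteDimensional V
  obtain ⟨R, hR⟩ := Submodule.ClosedComplemented.of_finiteDimensional W
  set i : V → E := fun v ↦ (v : E) + p with hi
  set j : W → F := fun w ↦ (w : F) + f p with hj
  have hi1 : LipschitzWith 1 i := LipschitzWith.of_dist_le_mul fun u v ↦ by simp [hi, Subtype.dist_eq]
  have hj1 : LipschitzWith 1 j := LipschitzWith.of_dist_le_mul fun u v ↦ by simp [hj, Subtype.dist_eq]
  set f' : V → W := fun v ↦ R (f (i v) - f p) with hf'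
  set g' : W → V := fun w ↦ P (f.symm (j w) - p) with hg'
  obtain ⟨K₁, hf'K⟩ : ∃ K₁, LipschitzWith K₁ f' :=
    ⟨_, R.lipschitz.comp ((hf.comp hi1).sub (LipschitzWith.const (f p)))⟩
  obtain ⟨K₂, hg'K⟩ : ∃ K₂, LipschitzWith K₂ g' :=
    ⟨_, P.lipschitz.comp ((hg.comp hj1).sub (LipschitzWith.const p))⟩
  have hjf (v : V) (hv : i v ∈ S) : j (f' v) = f (i v) := by
    have hm : f (i v) - f p ∈ W := AffineSubspace.vsub_mem_direction
      (subset_affineSpan ℝ _ (mem_image_of_mem f hv)) (subset_affineSpan ℝ _ hfp)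
    have := hR ⟨_, hm⟩
    simp only [hj, hf']
    rw [this, sub_add_cancel]
  have hig (w : W) (hw : j w ∈ f '' S) : i (g' w) = f.symm (j w) := by
    obtain ⟨s, hs, hsw⟩ := hw
    have hm : f.symm (j w) - p ∈ V := by
      rw [← hsw, f.symm_apply_apply]
      exact AffineSubspace.vsub_mem_direction (subset_affineSpan ℝ _ hs) (subset_affineSpan ℝ _ hp)
    have := hP ⟨_, hm⟩
    simp only [hi, hg']
    rw [this, sub_add_cancel]
  have hii : Function.Injective i := fun u v h ↦ Subtype.ext (add_right_cancel h)
  have hji : Function.Injective j := fun u v h ↦ Subtype.ext (add_right_cancel h)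
  set A : Set V := i ⁻¹' S with hA
  set C : Set W := j ⁻¹' (f '' S) with hC
  have hfA : MapsTo f' A C := fun v hv ↦ by
    change j (f' v) ∈ f '' S
    rw [hjf v hv]
    exact mem_image_of_mem f hv
  have hgC : MapsTo g' C A := fun w hw ↦ by
    change i (g' w) ∈ S
    rw [hig w hw]
    obtain ⟨s, hs, hsw⟩ := hw
    rwa [← hsw, f.symm_apply_apply]
  have hgf : LeftInvOn g' f' A := fun v hv ↦ hii <| by
    rw [hig _ (hfA hv), hjf v hv, f.symm_apply_apply]
  have hfg : LeftInvOn f' g' C := fun w hw ↦ hji <| by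
    rw [hjf _ (hgC hw), hig w hw, f.apply_symm_apply]
  have hCconv : Convex ℝ C := (hfS.translate_preimage_left (f p)).linear_preimage W.subtype
  obtain ⟨w₀, hw₀, hw₀p⟩ := hy
  have hw₀0 : w₀ = 0 := hji (by rw [hw₀p]; simp [hj])
  rw [hw₀0] at hw₀
  obtain ⟨v, hv, rfl⟩ := hx
  have hCne : (interior C).Nonempty := ⟨_, hw₀⟩
  have hAne : (interior A).Nonempty := ⟨_, hv⟩
  have hdimC := Real.dimH_of_nonempty_interior hCne
  have hdimA := Real.dimH_of_nonempty_interior hAne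
  have hdim : finrank ℝ V = finrank ℝ W := by
    have h1 : dimH C ≤ dimH A := (dimH_mono (show C ⊆ f' '' A from
      fun w hw ↦ ⟨g' w, hgC hw, hfg hw⟩)).trans
      (hf'K.dimH_image_le A)
    have h2 : dimH A ≤ dimH C := (dimH_mono (show A ⊆ g' '' C from
      fun v hv ↦ ⟨f' v, hfA hv, hgf hv⟩)).trans
      (hg'K.dimH_image_le C)
    rw [hdimC, hdimA] at h1 h2
    exact_mod_cast le_antisymm h2 h1
  refine ⟨f' v, ?_, hjf v (show v ∈ A from interior_subset hv)⟩
  rw [← hCconv.interior_closure_eq_interior_of_nonempty_interior hCne]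
  refine map_mem_interior_of_bilipschitz (A := closure A) (K := max K₁ K₂) hdim
    hCconv.closure isClosed_closure
    (mem_of_superset (mem_interior_iff_mem_nhds.1 hw₀) subset_closure)
    (hf'K.weaken (le_max_left _ _)) (hg'K.weaken (le_max_right _ _))
    (hfA.closure hf'K.continuous) ?_ ?_ (interior_mono subset_closure hv)
  · exact EqOn.closure hfg (hf'K.continuous.comp hg'K.continuous) continuous_id
  · exact EqOn.closure hgf (hg'K.continuous.comp hf'K.continuous) continuous_id

/-- A bi-Lipschitz bijection mapping a convex set to a convex set maps the relative interior onto
the relative interior. -/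
lemma image_intrinsicInterior_of_bilipschitz {K K' : ℝ≥0} (f : E ≃ F) (hf : LipschitzWith K f)
    (hg : LipschitzWith K' f.symm) {S : Set E} (hS : Convex ℝ S) (hfS : Convex ℝ (f '' S)) :
    f '' intrinsicInterior ℝ S = intrinsicInterior ℝ (f '' S) := by
  have hf' := hf.weaken (le_max_left K K')
  have hg' := hg.weaken (le_max_right K K')
  refine (image_intrinsicInterior_subset_of_bilipschitz f hf' hg' hfS).antisymm ?_
  have hSS : f.symm '' (f '' S) = S := f.symm_image_image S
  have h := image_intrinsicInterior_subset_of_bilipschitz f.symm hg' hf' (by rwa [hSS])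
  rw [hSS] at h
  rwa [← f.symm.image_subset, f.symm_image_image]

end

end BilipschitzRelativeInterior

/-- a bi-Lipschitz bijection mapping a convex set to a convex set maps
relative interior onto relative interior; consequently, for `S ∈ 𝒮` the set
`ri(S) := φ⁻¹(ri(φ(S)))` does not depend on the admissible choice of `φ`. -/
theorem stmt8 (d : ℕ) :
    (∀ f : X d ≃ X d, (∃ K : ℝ≥0, LipschitzWith K f) → (∃ K : ℝ≥0, LipschitzWith K f.symm) →
      ∀ S : Set (X d), Convex ℝ S → Convex ℝ (f '' S) →
        f '' intrinsicInterior ℝ S = intrinsicInterior ℝ (f '' S)) ∧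
    (∀ S : Set (X d), MemS d S → ∀ φ₁ φ₂ : X d ≃ X d,
      Admissible d φ₁ S → Admissible d φ₂ S →
        φ₁.symm '' intrinsicInterior ℝ (φ₁ '' S) =
          φ₂.symm '' intrinsicInterior ℝ (φ₂ '' S)) := by
  have main : ∀ f : X d ≃ X d, (∃ K : ℝ≥0, LipschitzWith K f) →
      (∃ K : ℝ≥0, LipschitzWith K f.symm) → ∀ S : Set (X d), Convex ℝ S → Convex ℝ (f '' S) →
        f '' intrinsicInterior ℝ S = intrinsicInterior ℝ (f '' S) := by
    rintro f ⟨K, hf⟩ ⟨K', hg⟩ S hS hfS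
    exact image_intrinsicInterior_of_bilipschitz f hf hg hS hfS
  refine ⟨main, ?_⟩
  rintro S - φ₁ φ₂ ⟨⟨K₁, h₁⟩, ⟨K₁', h₁'⟩, hc₁⟩ ⟨⟨K₂, h₂⟩, ⟨K₂', h₂'⟩, hc₂⟩
  have himg : (φ₁.symm.trans φ₂) '' (φ₁ '' S) = φ₂ '' S := by
    rw [Equiv.coe_trans, image_comp, φ₁.symm_image_image]
  have h := main (φ₁.symm.trans φ₂) ⟨_, h₂.comp h₁'⟩ ⟨_, h₁.comp h₂'⟩ (φ₁ '' S) hc₁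
    (by rwa [himg])
  rw [himg] at h
  rw [← h, Equiv.coe_trans, image_comp, φ₂.symm_image_image]

end
end

section
/- For any solution of the multi-agent system, the set-valued function t ↦ Ṽ(x̃(t)) := σ(π(x̃(t))) is non-increasing along the solution: for all t, Ṽ(x̃(t+1)) ⊆ Ṽ(x̃(t)). More concretely: let σ : 2^X → 2^X satisfy S ⊆ σ(S), σ(σ(S)) = σ(S), and monotonicity (S' ⊆ S implies σ(S') ⊆ σ(S)); let n ≥ 1, h ≥ 1 be integers and x : ℤ → ({1,…,n} → X) a trajectory such that for every time t and every k ∈ {1,…,n}, x_k(t+1) ∈ σ(π(t)) where π(t) := { x_k(t−j) : k ∈ {1,…,n}, 0 ≤ j ≤ h−1 }. Then σ(π(t+1)) ⊆ σ(π(t)) for all t. -/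
open Set

noncomputable section

/-- `π(t)`: the finite set of present and delayed positions
`{ x_k(t−j) : k ∈ {1,…,n}, 0 ≤ j ≤ h−1 }` at time `t`. -/
def piSet (d n h : ℕ) (x : ℤ → Fin n → X d) (t : ℤ) : Set (X d) :=
  {p | ∃ k : Fin n, ∃ j : ℕ, j < h ∧ p = x (t - (j : ℤ)) k}

/-- if `σ` satisfies `S ⊆ σ(S)`, `σ∘σ = σ` and monotonicity, and the
trajectory satisfies `x_k(t+1) ∈ σ(π(t))` for all `t` and `k`, then the set-valued
function `t ↦ σ(π(t))` is non-increasing: `σ(π(t+1)) ⊆ σ(π(t))` for all `t`. -/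
theorem stmt13 (d n h : ℕ) (hn : 1 ≤ n) (hh : 1 ≤ h)
    (σ : Set (X d) → Set (X d))
    (hsub : ∀ S : Set (X d), S ⊆ σ S)
    (hidem : ∀ S : Set (X d), σ (σ S) = σ S)
    (hmono : ∀ S S' : Set (X d), S' ⊆ S → σ S' ⊆ σ S)
    (x : ℤ → Fin n → X d)
    (hdyn : ∀ t : ℤ, ∀ k : Fin n, x (t + 1) k ∈ σ (piSet d n h x t)) :
    ∀ t : ℤ, σ (piSet d n h x (t + 1)) ⊆ σ (piSet d n h x t) := by
  intro t
  rw [← hidem (piSet d n h x t)]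
  apply hmono
  rintro p ⟨k, j, hj, rfl⟩
  cases j with
  | zero => simpa using hdyn t k
  | succ i =>
    refine hsub _ ⟨k, i, Nat.lt_of_succ_lt hj, ?_⟩
    congr 1
    push_cast
    ring_nf

end
end

section
/- (Theorem 3, uniform stability) Let e : ℕ × 𝒳 ⇉ 𝒳 be a set-valued map with closed values, with associated difference inclusion x(t+1) ∈ e(t, x(t)); let Φ be a set of equilibrium points, i.e. φ ∈ Φ implies φ ∈ e(t,φ) for all t ∈ ℕ. Let V : 𝒳 ⇉ 𝒳 be an upper semicontinuous set-valued function satisfying (i) x ∈ V(x) for all x ∈ 𝒳, and (ii) ∪_{y ∈ e(t,x)} V(y) ⊆ V(x) for all t ∈ ℕ and x ∈ 𝒳. If V(φ) = {φ} for all φ ∈ Φ, then the system is uniformly stable with respect to Φ: for each φ ∈ Φ and each c₂ > 0 there is c₁ > 0 such that for every t₀ ∈ ℕ, every solution ζ with ‖ζ(t₀) − φ‖ < c₁ satisfies ‖ζ(t) − φ‖ < c₂ for all t ≥ t₀. -/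
open Set

noncomputable section

/-- The state space `𝒳 = ℝ^m`. -/
abbrev Xc (m : ℕ) := EuclideanSpace ℝ (Fin m)

/-- Upper semicontinuity of a set-valued function `V`: for every `x` and `ε > 0`
there is `δ > 0` such that `‖y − x‖ < δ` implies that `V y` is contained in the
open `ε`-neighbourhood of `V x`. -/
def USC (m : ℕ) (V : Xc m → Set (Xc m)) : Prop :=
  ∀ x : Xc m, ∀ ε : ℝ, 0 < ε → ∃ δ : ℝ, 0 < δ ∧
    ∀ y : Xc m, dist y x < δ → V y ⊆ Metric.thickening ε (V x)

/-- Theorem 3, uniform stability: given the difference inclusion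
`x(t+1) ∈ e(t, x(t))` with equilibrium set `Φ`, and an upper semicontinuous set-valued
function `V` with `x ∈ V(x)` and `∪_{y ∈ e(t,x)} V(y) ⊆ V(x)`, if `V(φ) = {φ}` on `Φ`
then the system is uniformly stable with respect to `Φ`. -/
theorem stmt17 (m : ℕ)
    (e : ℕ × Xc m → Set (Xc m)) (hclosed : ∀ p, IsClosed (e p))
    (Φ : Set (Xc m)) (hΦ : ∀ φ ∈ Φ, ∀ t : ℕ, φ ∈ e (t, φ))
    (V : Xc m → Set (Xc m)) (husc : USC m V)
    (hV1 : ∀ x : Xc m, x ∈ V x)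
    (hV2 : ∀ t : ℕ, ∀ x : Xc m, ∀ y ∈ e (t, x), V y ⊆ V x)
    (hVΦ : ∀ φ ∈ Φ, V φ = {φ}) :
    ∀ φ ∈ Φ, ∀ c₂ : ℝ, 0 < c₂ → ∃ c₁ : ℝ, 0 < c₁ ∧ ∀ t₀ : ℕ, ∀ ζ : ℕ → Xc m,
      (∀ t : ℕ, t₀ ≤ t → ζ (t + 1) ∈ e (t, ζ t)) → dist (ζ t₀) φ < c₁ →
      ∀ t : ℕ, t₀ ≤ t → dist (ζ t) φ < c₂ := by
  intro φ hφ c₂ hc₂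
  obtain ⟨δ, hδ, hV⟩ := husc φ c₂ hc₂
  refine ⟨δ, hδ, fun t₀ ζ hζ h₀ t ht => ?_⟩
  have hsub : V (ζ t) ⊆ V (ζ t₀) := by
    induction t, ht using Nat.le_induction with
    | base => exact Subset.rfl
    | succ t ht ih => exact (hV2 t (ζ t) _ (hζ t ht)).trans ih
  have hmem := hV (ζ t₀) h₀ (hsub (hV1 (ζ t)))
  rwa [hVΦ φ hφ, Metric.thickening_singleton, Metric.mem_ball] at hmem

end
end

section
/- (Theorem 3, uniform boundedness) Let e : ℕ × 𝒳 ⇉ 𝒳 be a set-valued map with closed values, with associated difference inclusion x(t+1) ∈ e(t, x(t)); let Φ be a set of equilibrium points, i.e. φ ∈ Φ implies φ ∈ e(t,φ) for all t ∈ ℕ. Let V : 𝒳 ⇉ 𝒳 be an upper semicontinuous set-valued function satisfying (i) x ∈ V(x) for all x ∈ 𝒳, and (ii) ∪_{y ∈ e(t,x)} V(y) ⊆ V(x) for all t ∈ ℕ and x ∈ 𝒳. If V(x) is bounded for every x ∈ 𝒳, then the system is uniformly bounded with respect to Φ: for each φ ∈ Φ and each c₁ > 0 there is c₂ > 0 such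 that for every t₀ ∈ ℕ, every solution ζ with ‖ζ(t₀) − φ‖ < c₁ satisfies ‖ζ(t) − φ‖ < c₂ for all t ≥ t₀. -/
open Set

noncomputable section

/-- An upper semicontinuous set-valued function with bounded values maps compact sets
to bounded sets. -/
theorem USC.isBounded_biUnion {m : ℕ} {V : Xc m → Set (Xc m)} (husc : USC m V)
    (hVbdd : ∀ x, Bornology.IsBounded (V x)) {K : Set (Xc m)} (hK : IsCompact K) :
    Bornology.IsBounded (⋃ x ∈ K, V x) := by
  refine hK.induction_on (p := fun s => Bornology.IsBounded (⋃ x ∈ s, V x)) (by simp)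
    (fun s t hst ht => ht.subset (biUnion_subset_biUnion_left hst)) (fun s t hs ht => ?_)
    (fun x _ => ?_)
  · rw [biUnion_union]
    exact hs.union ht
  · obtain ⟨δ, hδ, hV⟩ := husc x 1 one_pos
    exact ⟨Metric.ball x δ, mem_nhdsWithin_of_mem_nhds (Metric.ball_mem_nhds x hδ),
      (hVbdd x).thickening.subset (iUnion₂_subset hV)⟩

/-- If `V` does not grow along a difference inclusion, then neither does it along solutions. -/
theorem subset_of_solution {m : ℕ} {e : ℕ × Xc m → Set (Xc m)} {V : Xc m → Set (Xc m)}
    (hV : ∀ t : ℕ, ∀ x : Xc m, ∀ y ∈ e (t, x), V y ⊆ V x) {t₀ : ℕ} {ζ : ℕ → Xc m}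
    (hζ : ∀ t : ℕ, t₀ ≤ t → ζ (t + 1) ∈ e (t, ζ t)) {t : ℕ} (ht : t₀ ≤ t) :
    V (ζ t) ⊆ V (ζ t₀) := by
  induction t, ht using Nat.le_induction with
  | base => exact subset_rfl
  | succ t ht ih => exact (hV t _ _ (hζ t ht)).trans ih

/-- Theorem 3, uniform boundedness: given the difference inclusion
`x(t+1) ∈ e(t, x(t))` with equilibrium set `Φ`, and an upper semicontinuous set-valued
function `V` with `x ∈ V(x)` and `∪_{y ∈ e(t,x)} V(y) ⊆ V(x)`, if `V(x)` is bounded for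
every `x` then the system is uniformly bounded with respect to `Φ`. -/
theorem stmt18 (m : ℕ)
    (e : ℕ × Xc m → Set (Xc m)) (hclosed : ∀ p, IsClosed (e p))
    (Φ : Set (Xc m)) (hΦ : ∀ φ ∈ Φ, ∀ t : ℕ, φ ∈ e (t, φ))
    (V : Xc m → Set (Xc m)) (husc : USC m V)
    (hV1 : ∀ x : Xc m, x ∈ V x)
    (hV2 : ∀ t : ℕ, ∀ x : Xc m, ∀ y ∈ e (t, x), V y ⊆ V x)
    (hVbdd : ∀ x : Xc m, Bornology.IsBounded (V x)) :
    ∀ φ ∈ Φ, ∀ c₁ : ℝ, 0 < c₁ → ∃ c₂ : ℝ, 0 < c₂ ∧ ∀ t₀ : ℕ, ∀ ζ : ℕ → Xc m,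
      (∀ t : ℕ, t₀ ≤ t → ζ (t + 1) ∈ e (t, ζ t)) → dist (ζ t₀) φ < c₁ →
      ∀ t : ℕ, t₀ ≤ t → dist (ζ t) φ < c₂ := by
  intro φ _ c₁ _
  obtain ⟨r, hr, hsub⟩ := (husc.isBounded_biUnion hVbdd
    (isCompact_closedBall φ c₁)).subset_ball_lt 0 φ
  refine ⟨r, hr, fun t₀ ζ hζ h₀ t ht => hsub ?_⟩
  exact mem_biUnion (Metric.mem_closedBall.2 h₀.le) (subset_of_solution hV2 hζ ht (hV1 (ζ t)))

end
end

section
/- (Theorem 3, uniform global asymptotic stability) Let e : ℕ × 𝒳 ⇉ 𝒳 be a set-valued map with closed values, with associated difference inclusion x(t+1) ∈ e(t, x(t)); let Φ be a set of equilibrium points, i.e. φ ∈ Φ implies φ ∈ e(t,φ) for all t ∈ ℕ. Let V : 𝒳 ⇉ 𝒳 be an upper semicontinuous set-valued function satisfying (i) x ∈ V(x) for all x ∈ 𝒳, and (ii) ∪_{y ∈ e(t,x)} V(y) ⊆ V(x) for all t ∈ ℕ and x ∈ 𝒳. Suppose in addition there are functions μ : Image(V) → [0,∞) and β : 𝒳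 → [0,∞) with: (iii) x ↦ μ(V(x)) is bounded uniformly for x in bounded subsets of 𝒳; (iv) β is lower semicontinuous and positive definite with respect to Φ (β(φ) = 0 for φ ∈ Φ and β(x) > 0 for x ∉ Φ); (v) sup_{y ∈ e(t,x)} μ(V(y)) − μ(V(x)) ≤ −β(x) for all t ∈ ℕ and x ∈ 𝒳. If V(φ) = {φ} for all φ ∈ Φ and V(x) is bounded for all x ∈ 𝒳, then the system is uniformly globally asymptotically stable with respect to Φ: it is uniformly stable, uniformly bounded, and uniformly globally attractive, i.e. for each φ₁ ∈ Φ and all c₁, c₂ > 0 there is T ≥ 0 such that for every t₀ ∈ ℕ, every solution ζ with ‖ζ(t₀) − φ₁‖ < c₁ admits φ₂ ∈ Φ with ‖ζ(t) − φ₂‖ < c₂ for all t ≥ t₀ + T. -/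
open Set

noncomputable section

theorem USC.exists_subset_ball_of_eq_singleton {m : ℕ} {V : Xc m → Set (Xc m)} (husc : USC m V)
    {φ : Xc m} (hφ : V φ = {φ}) {ε : ℝ} (hε : 0 < ε) :
    ∃ δ > 0, ∀ y, dist y φ < δ → V y ⊆ Metric.ball φ ε := by
  obtain ⟨δ, hδ, h⟩ := husc φ ε hε
  refine ⟨δ, hδ, fun y hy => ?_⟩
  simpa only [hφ, Metric.thickening_singleton] using h y hy

theorem LowerSemicontinuousOn.exists_pos_forall_le {X : Type*} [TopologicalSpace X]
    {s : Set X} {f : X → ℝ} (hf : LowerSemicontinuousOn f s) (hs : IsCompact s)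
    (hpos : ∀ x ∈ s, 0 < f x) : ∃ b > 0, ∀ x ∈ s, b ≤ f x := by
  rcases s.eq_empty_or_nonempty with rfl | hne
  · exact ⟨1, one_pos, by simp⟩
  · obtain ⟨a, ha, hmin⟩ := hf.exists_isMinOn hne hs
    exact ⟨f a, hpos a ha, fun x hx => hmin hx⟩

/-- Along a solution, the images under a Lyapunov set-valued function are nested. -/
theorem lyapunov_subset_of_le {X : Type*} {e : ℕ × X → Set X} {V : X → Set X}
    (hV : ∀ t x, ∀ y ∈ e (t, x), V y ⊆ V x) {t₀ : ℕ} {ζ : ℕ → X}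
    (hζ : ∀ t, t₀ ≤ t → ζ (t + 1) ∈ e (t, ζ t)) {s t : ℕ} (hs : t₀ ≤ s) (hst : s ≤ t) :
    V (ζ t) ⊆ V (ζ s) := by
  induction t, hst using Nat.le_induction with
  | base => exact Subset.rfl
  | succ t hst ih => exact (hV t _ _ (hζ t (hs.trans hst))).trans ih

/-- Theorem 3, uniform global asymptotic stability: under the
set-valued Lyapunov conditions (i)–(v), if `V(φ) = {φ}` on `Φ` and `V(x)` is bounded
for all `x`, the system is uniformly stable, uniformly bounded, and uniformly globally
attractive with respect to `Φ`. -/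
theorem stmt19 (m : ℕ)
    (e : ℕ × Xc m → Set (Xc m)) (hclosed : ∀ p, IsClosed (e p))
    (Φ : Set (Xc m)) (hΦ : ∀ φ ∈ Φ, ∀ t : ℕ, φ ∈ e (t, φ))
    (V : Xc m → Set (Xc m)) (husc : USC m V)
    (hV1 : ∀ x : Xc m, x ∈ V x)
    (hV2 : ∀ t : ℕ, ∀ x : Xc m, ∀ y ∈ e (t, x), V y ⊆ V x)
    (μ : Set (Xc m) → ℝ) (β : Xc m → ℝ)
    -- μ takes values in [0,∞) on the image of V
    (hμnn : ∀ x : Xc m, 0 ≤ μ (V x))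
    -- (iii) x ↦ μ(V(x)) is bounded uniformly on bounded subsets
    (hμbdd : ∀ B : Set (Xc m), Bornology.IsBounded B → ∃ M : ℝ, ∀ x ∈ B, μ (V x) ≤ M)
    -- (iv) β is lower semicontinuous, nonnegative and positive definite w.r.t. Φ
    (hβlsc : LowerSemicontinuous β) (hβnn : ∀ x : Xc m, 0 ≤ β x)
    (hβ0 : ∀ φ ∈ Φ, β φ = 0) (hβpos : ∀ x : Xc m, x ∉ Φ → 0 < β x)
    -- (v) decrease condition
    (hdec : ∀ t : ℕ, ∀ x : Xc m, ∀ y ∈ e (t, x), μ (V y) - μ (V x) ≤ -β x)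
    (hVΦ : ∀ φ ∈ Φ, V φ = {φ})
    (hVbdd : ∀ x : Xc m, Bornology.IsBounded (V x)) :
    -- uniform stability
    ((∀ φ ∈ Φ, ∀ c₂ : ℝ, 0 < c₂ → ∃ c₁ : ℝ, 0 < c₁ ∧ ∀ t₀ : ℕ, ∀ ζ : ℕ → Xc m,
      (∀ t : ℕ, t₀ ≤ t → ζ (t + 1) ∈ e (t, ζ t)) → dist (ζ t₀) φ < c₁ →
      ∀ t : ℕ, t₀ ≤ t → dist (ζ t) φ < c₂) ∧
    -- uniform boundedness
    (∀ φ ∈ Φ, ∀ c₁ : ℝ, 0 < c₁ → ∃ c₂ : ℝ, 0 < c₂ ∧ ∀ t₀ : ℕ, ∀ ζ : ℕ → Xc m,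
      (∀ t : ℕ, t₀ ≤ t → ζ (t + 1) ∈ e (t, ζ t)) → dist (ζ t₀) φ < c₁ →
      ∀ t : ℕ, t₀ ≤ t → dist (ζ t) φ < c₂) ∧
    -- uniform global attractivity
    (∀ φ₁ ∈ Φ, ∀ c₁ c₂ : ℝ, 0 < c₁ → 0 < c₂ → ∃ T : ℕ, ∀ t₀ : ℕ, ∀ ζ : ℕ → Xc m,
      (∀ t : ℕ, t₀ ≤ t → ζ (t + 1) ∈ e (t, ζ t)) → dist (ζ t₀) φ₁ < c₁ →
      ∃ φ₂ ∈ Φ, ∀ t : ℕ, t₀ + T ≤ t → dist (ζ t) φ₂ < c₂)) := by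
  have hstable : ∀ φ ∈ Φ, ∀ c₂ : ℝ, 0 < c₂ → ∃ c₁ : ℝ, 0 < c₁ ∧ ∀ t₀ : ℕ, ∀ ζ : ℕ → Xc m,
      (∀ t : ℕ, t₀ ≤ t → ζ (t + 1) ∈ e (t, ζ t)) → ∀ s : ℕ, t₀ ≤ s → dist (ζ s) φ < c₁ →
      ∀ t : ℕ, s ≤ t → dist (ζ t) φ < c₂ := by
    intro φ hφ c₂ hc₂
    obtain ⟨δ, hδ, h⟩ := husc.exists_subset_ball_of_eq_singleton (hVΦ φ hφ) hc₂
    exact ⟨δ, hδ, fun t₀ ζ hζ s hs hd t hst =>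
      h _ hd (lyapunov_subset_of_le hV2 hζ hs hst (hV1 _))⟩
  have hbounded : ∀ φ ∈ Φ, ∀ c₁ : ℝ, 0 < c₁ → ∃ c₂ : ℝ, 0 < c₂ ∧ ∀ t₀ : ℕ, ∀ ζ : ℕ → Xc m,
      (∀ t : ℕ, t₀ ≤ t → ζ (t + 1) ∈ e (t, ζ t)) → dist (ζ t₀) φ < c₁ →
      ∀ t : ℕ, t₀ ≤ t → dist (ζ t) φ < c₂ := by
    intro φ _ c₁ _
    obtain ⟨r, hr, hsub⟩ :=
      (husc.isBounded_biUnion hVbdd (isCompact_closedBall φ c₁)).subset_ball_lt 0 φ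
    exact ⟨r, hr, fun t₀ ζ hζ hd t ht => hsub (mem_biUnion (Metric.mem_closedBall.2 hd.le)
      (lyapunov_subset_of_le hV2 hζ le_rfl ht (hV1 _)))⟩
  refine ⟨fun φ hφ c₂ hc₂ => ?_, hbounded, fun φ₁ hφ₁ c₁ c₂ hc₁ hc₂ => ?_⟩
  · obtain ⟨c₁, hc₁, h⟩ := hstable φ hφ c₂ hc₂
    exact ⟨c₁, hc₁, fun t₀ ζ hζ => h t₀ ζ hζ t₀ le_rfl⟩
  · obtain ⟨R, _, hR⟩ := hbounded φ₁ hφ₁ c₁ hc₁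
    choose! δ hδ hstay using fun φ hφ => hstable φ hφ c₂ hc₂
    let U : Set (Xc m) := ⋃ φ ∈ Φ, Metric.ball φ (δ φ)
    have hU : IsOpen U := isOpen_biUnion fun _ _ => Metric.isOpen_ball
    obtain ⟨b, hb, hbβ⟩ := (hβlsc.lowerSemicontinuousOn _).exists_pos_forall_le
      ((isCompact_closedBall φ₁ R).diff hU) fun x hx =>
        hβpos x fun hxΦ => hx.2 (mem_biUnion hxΦ (Metric.mem_ball_self (hδ x hxΦ)))
    obtain ⟨M, hM⟩ := hμbdd _ (Metric.isBounded_ball (x := φ₁) (r := c₁))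
    obtain ⟨T, hT⟩ := exists_nat_gt (M / b)
    refine ⟨T, fun t₀ ζ hζ hd => ?_⟩
    have hentry : ∃ k ≤ T, ζ (t₀ + k) ∈ U := by
      by_contra! hout
      have hdecay : ∀ k ≤ T, μ (V (ζ (t₀ + k))) ≤ M - k * b := by
        intro k
        induction k with
        | zero => simpa using hM _ (Metric.mem_ball.2 hd)
        | succ k ih =>
          intro hk
          have hle := t₀.le_add_right k
          have hβk := hbβ (ζ (t₀ + k)) ⟨(hR t₀ ζ hζ hd _ hle).le, hout k (by lia)⟩
          have hstep := hdec _ _ _ (hζ _ hle)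
          have := ih (by lia)
          rw [← add_assoc]
          push_cast
          linarith
      have := hdecay T le_rfl
      have := hμnn (ζ (t₀ + T))
      rw [div_lt_iff₀ hb] at hT
      linarith
    obtain ⟨k, hk, hkU⟩ := hentry
    obtain ⟨φ₂, hφ₂, hdist⟩ := mem_iUnion₂.1 hkU
    exact ⟨φ₂, hφ₂, fun t ht => hstay φ₂ hφ₂ t₀ ζ hζ _ (t₀.le_add_right k) hdist t (by lia)⟩

end
end
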